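/- Let (X, μ) be a probability space and T : X → X an ergodic measure-preserving transformation. Suppose f ∈ L¹(μ) is real-valued with ∫ f dμ = 0, and there exists a measurable set E with μ(E) > 0 such that for every x ∈ E, either A_N f(x) ≥ 0 for all sufficiently large N, or A_N f(x) ≤ 0 for all sufficiently large N. Then there exists a measurable function F : X → ℝ having either an upper barrier or a lower barrier such that f = F − F∘T almost everywhere. -/

import Mathlib

open MeasureTheory Filter

/-- Birkhoff (ergodic) average `A_N f(x) = (1/N) ∑_{n=1}^N f(Tⁿ x)`. -/
noncomputable def birkhoffAvg {X : Type*} (T : X → X) (f : X → ℝ) (N : ℕ) (x : X) : ℝ :=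
  (N : ℝ)⁻¹ * ∑ n ∈ Finset.Icc 1 N, f (T^[n] x)

/-- `F` has an upper barrier: a set of positive measure on which `F` is constant `p`,
with `F ≤ p` a.e. -/
def HasUpperBarrier {X : Type*} [MeasurableSpace X] (μ : Measure X) (F : X → ℝ) : Prop :=
  ∃ P : Set X, MeasurableSet P ∧ 0 < μ P ∧
    ∃ p : ℝ, (∀ x ∈ P, F x = p) ∧ ∀ᵐ y ∂μ, F y ≤ p

/-- `F` has a lower barrier: a set of positive measure on which `F` is constant `q`,
with `F ≥ q` a.e. -/
def HasLowerBarrier {X : Type*} [MeasurableSpace X] (μ : Measure X) (F : X → ℝ) : Prop :=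
  ∃ Q : Set X, MeasurableSet Q ∧ 0 < μ Q ∧
    ∃ q : ℝ, (∀ x ∈ Q, F x = q) ∧ ∀ᵐ y ∂μ, q ≤ F y

/-- For an ergodic finite-measure-preserving map, almost every orbit visits a given measurable set
of positive measure infinitely often. -/
theorem Ergodic.ae_frequently_iterate_mem {X : Type*} [MeasurableSpace X] {μ : Measure X}
    [IsFiniteMeasure μ] {T : X → X} (hT : Ergodic T μ) {s : Set X} (hs : MeasurableSet s)
    (h0 : μ s ≠ 0) : ∀ᵐ x ∂μ, ∃ᶠ n in atTop, T^[n] x ∈ s := by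
  have hmeas : MeasurableSet {x | ∃ᶠ n in atTop, T^[n] x ∈ s} := by
    have : {x | ∃ᶠ n in atTop, T^[n] x ∈ s} = limsup (fun n => T^[n] ⁻¹' s) atTop := by
      ext x
      simp [mem_limsup_iff_frequently_mem]
    rw [this]
    exact .measurableSet_limsup fun n => hT.measurable.iterate n hs
  have hinv : T ⁻¹' {x | ∃ᶠ n in atTop, T^[n] x ∈ s} = {x | ∃ᶠ n in atTop, T^[n] x ∈ s} := by
    ext x
    change (∃ᶠ n in atTop, T^[n + 1] x ∈ s) ↔ ∃ᶠ n in atTop, T^[n] x ∈ s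
    conv_rhs => rw [← map_add_atTop_eq_nat 1, frequently_map]
  refine (hT.toPreErgodic.ae_mem_or_ae_notMem hmeas hinv).resolve_right fun hnot => ?_
  have hret := hT.toMeasurePreserving.conservative.frequently_ae_mem_and_frequently_image_mem
    hs.nullMeasurableSet h0
  obtain ⟨x, ⟨-, hx⟩, hx'⟩ := (hret.and_eventually hnot).exists
  exact hx' hx

/-- If `G ≤ 0` and the coboundary `G - G ∘ T` is dominated by an integrable function of
nonpositive integral, then the two agree almost everywhere. -/
theorem MeasureTheory.MeasurePreserving.ae_eq_sub_comp_of_sub_comp_le {X : Type*}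
    [MeasurableSpace X] {μ : Measure X} [IsFiniteMeasure μ] {T : X → X}
    (hT : MeasurePreserving T μ μ) {f G : X → ℝ} (hf : Integrable f μ) (hf0 : ∫ x, f x ∂μ ≤ 0)
    (hG : Measurable G) (hG0 : ∀ x, G x ≤ 0) (hle : ∀ᵐ x ∂μ, G x - G (T x) ≤ f x) :
    f =ᵐ[μ] fun x => G x - G (T x) := by
  let H : ℕ → X → ℝ := fun k x => max (G x) (-k)
  let a : X → ℝ := fun x => |f x| - (G x - G (T x))
  let b : ℕ → X → ℝ := fun k x => |f x| - (H k x - H k (T x))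
  have hHm : ∀ k, Measurable (H k) := fun k => hG.max measurable_const
  have hHint : ∀ k, Integrable (H k) μ := fun k => by
    refine Integrable.of_bound (hHm k).aestronglyMeasurable (k : ℝ) (ae_of_all _ fun x => ?_)
    rw [Real.norm_eq_abs, abs_le]
    exact ⟨le_max_right _ _, max_le ((hG0 x).trans k.cast_nonneg) (by
      linarith [k.cast_nonneg (α := ℝ)])⟩
  have hHT : ∀ k, Integrable (fun x => H k (T x)) μ := fun k =>
    hT.integrable_comp_of_integrable (hHint k)
  have hHTint : ∀ k, ∫ x, H k (T x) ∂μ = ∫ x, H k x ∂μ := fun k => by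
    have := integral_map (μ := μ) hT.measurable.aemeasurable
      (f := H k) (hHm k).aestronglyMeasurable
    rw [hT.map_eq] at this
    exact this.symm
  have hbint : ∀ k, Integrable (b k) μ := fun k => hf.abs.sub ((hHint k).sub (hHT k))
  have hbval : ∀ k, ∫ x, b k x ∂μ = ∫ x, |f x| ∂μ := fun k => by
    have h1 := integral_sub hf.abs ((hHint k).sub (hHT k))
    have h2 := integral_sub (hHint k) (hHT k)
    rw [hHTint, sub_self] at h2
    simpa only [Pi.sub_apply, h2, sub_zero] using h1
  have hb0 : ∀ k, 0 ≤ᵐ[μ] b k := fun k => by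
    filter_upwards [hle] with x hx
    have h1 := le_abs_self (f x)
    have h2 := abs_nonneg (f x)
    have h3 : H k x ≤ H k (T x) + |f x| := by
      refine max_le ?_ ?_
      · linarith [le_max_left (G (T x)) (-(k : ℝ))]
      · linarith [le_max_right (G (T x)) (-(k : ℝ))]
    simp only [Pi.zero_apply, b]
    linarith
  have ha0 : 0 ≤ᵐ[μ] a := by
    filter_upwards [hle] with x hx
    have h1 := le_abs_self (f x)
    simp only [Pi.zero_apply, a]
    linarith
  have ham : AEStronglyMeasurable a μ :=
    hf.abs.aestronglyMeasurable.sub (hG.sub (hG.comp hT.measurable)).aestronglyMeasurable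
  have hHlim : ∀ y, ∀ᶠ k : ℕ in atTop, H k y = G y := fun y => by
    obtain ⟨n, hn⟩ := exists_nat_ge (-G y)
    filter_upwards [eventually_ge_atTop n] with k hk
    have : (n : ℝ) ≤ k := by exact_mod_cast hk
    exact max_eq_left (by linarith)
  have hlim : ∀ x, liminf (fun k => ENNReal.ofReal (b k x)) atTop = ENNReal.ofReal (a x) := by
    intro x
    refine Tendsto.liminf_eq (tendsto_const_nhds.congr' ?_)
    filter_upwards [hHlim x, hHlim (T x)] with k h1 h2
    simp only [a, b, h1, h2]
  have hfatou : ∫⁻ x, ENNReal.ofReal (a x) ∂μ ≤ ENNReal.ofReal (∫ x, |f x| ∂μ) := by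
    have hmeas : ∀ k, AEMeasurable (fun x => ENNReal.ofReal (b k x)) μ := fun k =>
      (hbint k).aestronglyMeasurable.aemeasurable.ennreal_ofReal
    have := lintegral_liminf_le' (u := atTop) hmeas
    simp_rw [hlim, ← ofReal_integral_eq_lintegral_ofReal (hbint _) (hb0 _), hbval] at this
    simpa using this
  have haint : Integrable a μ :=
    ⟨ham, (hasFiniteIntegral_iff_ofReal ha0).2 (hfatou.trans_lt ENNReal.ofReal_lt_top)⟩
  have hale : ∫ x, a x ∂μ ≤ ∫ x, |f x| ∂μ := by
    rw [← ofReal_integral_eq_lintegral_ofReal haint ha0] at hfatou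
    exact (ENNReal.ofReal_le_ofReal_iff (integral_nonneg fun x => abs_nonneg _)).1 hfatou
  let h : X → ℝ := fun x => f x - (G x - G (T x))
  have hh : h = fun x => f x - |f x| + a x := by
    funext x
    simp only [h, a]
    ring
  have hhint : Integrable h μ := hh ▸ (hf.sub hf.abs).add haint
  have hh0 : 0 ≤ᵐ[μ] h := by
    filter_upwards [hle] with x hx
    simp only [Pi.zero_apply, h]
    linarith
  have hhval : ∫ x, h x ∂μ = 0 := by
    refine le_antisymm ?_ (integral_nonneg_of_ae hh0)
    have h1 := integral_add (hf.sub hf.abs) haint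
    simp only [Pi.sub_apply] at h1
    rw [hh, h1, integral_sub hf hf.abs]
    linarith
  filter_upwards [(integral_eq_zero_iff_of_nonneg_ae hh0 hhint).1 hhval] with x hx
  simp only [h, Pi.zero_apply] at hx
  linarith

/-- If the Birkhoff sums are eventually nonnegative on a non-null set of points, then `f` is a
coboundary whose transfer function is the infimum of the Birkhoff sums, and this function has an
upper barrier. -/
theorem exists_upperBarrier_of_frequently_birkhoffSum_nonneg {X : Type*} [MeasurableSpace X]
    {μ : Measure X} [IsFiniteMeasure μ] {T : X → X} (hT : Ergodic T μ) {f : X → ℝ}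
    (hfm : Measurable f) (hf : Integrable f μ) (hf0 : ∫ x, f x ∂μ ≤ 0)
    (hpos : ∃ᶠ x in ae μ, ∀ᶠ N in atTop, 0 ≤ birkhoffSum T f N x) :
    ∃ F : X → ℝ, Measurable F ∧ HasUpperBarrier μ F ∧ f =ᵐ[μ] fun x => F x - F (T x) := by
  let B : Set X := {x | BddBelow (Set.range fun n => birkhoffSum T f n x)}
  let G : X → ℝ := fun x => ⨅ n, birkhoffSum T f n x
  have hSm : ∀ n, Measurable (birkhoffSum T f n) := fun n =>
    Finset.measurable_sum _ fun k _ => hfm.comp (hT.measurable.iterate k)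
  have hGm : Measurable G := .iInf hSm
  have hBm : MeasurableSet B := measurableSet_bddBelow_range hSm
  have hBinv : T ⁻¹' B = B := by
    ext x
    constructor
    · rintro ⟨c, hc⟩
      refine ⟨min 0 (f x + c), ?_⟩
      rintro _ ⟨n, rfl⟩
      cases n with
      | zero => simp
      | succ n =>
        have : c ≤ birkhoffSum T f n (T x) := hc ⟨n, rfl⟩
        simp only [birkhoffSum_succ']
        exact (min_le_right _ _).trans (by linarith)
    · rintro ⟨c, hc⟩
      refine ⟨c - f x, ?_⟩
      rintro _ ⟨n, rfl⟩
      have : c ≤ birkhoffSum T f (n + 1) x := hc ⟨n + 1, rfl⟩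
      rw [birkhoffSum_succ'] at this
      simp only
      linarith
  have hBae : ∀ᵐ x ∂μ, x ∈ B := by
    refine (hT.toPreErgodic.ae_mem_or_ae_notMem hBm hBinv).resolve_right fun hnot => ?_
    obtain ⟨x, hx, hxB⟩ := (hpos.and_eventually hnot).exists
    have : IsBoundedUnder (· ≥ ·) atTop fun n => birkhoffSum T f n x := ⟨0, by simpa using hx⟩
    exact hxB this.bddBelow_range
  have hG0 : ∀ x, G x ≤ 0 := fun x => by
    by_cases hx : x ∈ B
    · simpa using ciInf_le hx 0
    · exact (Real.iInf_of_not_bddBelow hx).le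
  have hle : ∀ᵐ x ∂μ, G x - G (T x) ≤ f x := by
    filter_upwards [hBae] with x hx
    have : G x - f x ≤ G (T x) := le_ciInf fun n => by
      have := ciInf_le hx (n + 1)
      simp only [birkhoffSum_succ'] at this
      simp only [G]
      linarith
    linarith
  have hfG := hT.toMeasurePreserving.ae_eq_sub_comp_of_sub_comp_le hf hf0 hGm hG0 hle
  refine ⟨G, hGm, ?_, hfG⟩
  have hsum : ∀ᵐ x ∂μ, ∀ n, birkhoffSum T f n x = G x - G (T^[n] x) := by
    refine ae_all_iff.2 fun n => ?_
    filter_upwards [hT.quasiMeasurePreserving.birkhoffSum_ae_eq_of_ae_eq hfG n] with x hx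
    rw [hx]
    simp only [birkhoffSum, ← Function.iterate_succ_apply' T]
    simpa using Finset.sum_range_sub' (fun k => G (T^[k] x)) n
  have hrec : ∀ᵐ x ∂μ, ∀ q : ℚ, μ {y | (q : ℝ) < G y} ≠ 0 →
      ∃ᶠ n in atTop, (q : ℝ) < G (T^[n] x) := by
    refine ae_all_iff.2 fun q => ?_
    by_cases hq : μ {y | (q : ℝ) < G y} = 0
    · simp [hq]
    · filter_upwards [hT.ae_frequently_iterate_mem (measurableSet_lt measurable_const hGm) hq]
        with x hx _ using hx
  have hbd : ∀ᵐ x ∂μ, ∀ c, (∀ᵐ y ∂μ, G y ≤ c) → G x ≤ c := by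
    have hrat : ∀ᵐ x ∂μ, ∀ q : ℚ, (∀ᵐ y ∂μ, G y ≤ q) → G x ≤ q := by
      refine ae_all_iff.2 fun q => ?_
      by_cases hq : ∀ᵐ y ∂μ, G y ≤ q
      · filter_upwards [hq] with x hx _ using hx
      · simp [hq]
    filter_upwards [hrat] with x hx c hc
    exact le_of_forall_lt_rat_imp_le fun q hq => hx q (hc.mono fun y hy => hy.trans hq.le)
  have hmax : ∃ᶠ x in ae μ, ∀ᵐ y ∂μ, G y ≤ G x := by
    refine (hpos.and_eventually (hsum.and hrec)).mono ?_
    rintro x ⟨hx, hxs, hxr⟩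
    filter_upwards [hbd] with y hy
    refine le_of_forall_lt_rat_imp_le fun q hq => hy q ?_
    by_contra hne
    have hne' : μ {y | (q : ℝ) < G y} ≠ 0 := by simpa [ae_iff] using hne
    obtain ⟨n, hn, hn'⟩ := ((hxr q hne').and_eventually hx).exists
    rw [hxs] at hn'
    linarith
  obtain ⟨x₀, hx₀, hx₀b⟩ := (hmax.and_eventually hbd).exists
  refine ⟨{x | G x = G x₀}, hGm (measurableSet_singleton _), ?_, G x₀, fun x hx => hx, hx₀⟩
  refine pos_iff_ne_zero.2 (frequently_ae_mem_iff.1 ?_)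
  exact (hmax.and_eventually hx₀).mono fun x hx => le_antisymm hx.2 (hx₀b _ hx.1)

theorem stmt_3 {X : Type*} [MeasurableSpace X] (μ : Measure X) [IsProbabilityMeasure μ]
    (T : X → X) (hT : Ergodic T μ) (f : X → ℝ) (hfint : Integrable f μ)
    (hf0 : ∫ x, f x ∂μ = 0)
    (E : Set X) (hEmeas : MeasurableSet E) (hEpos : 0 < μ E)
    (hE : ∀ x ∈ E, (∀ᶠ N in atTop, 0 ≤ birkhoffAvg T f N x) ∨
      (∀ᶠ N in atTop, birkhoffAvg T f N x ≤ 0)) :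
    ∃ F : X → ℝ, Measurable F ∧ (HasUpperBarrier μ F ∨ HasLowerBarrier μ F) ∧
      f =ᵐ[μ] fun x => F x - F (T x) := by
  obtain ⟨g, hgm, hfg⟩ : ∃ g : X → ℝ, Measurable g ∧ f =ᵐ[μ] g :=
    ⟨hfint.aemeasurable.mk f, hfint.aemeasurable.measurable_mk, hfint.aemeasurable.ae_eq_mk⟩
  have hgint : Integrable g μ := hfint.congr hfg
  have hg0 : ∫ x, g x ∂μ = 0 := by rw [← integral_congr_ae hfg, hf0]
  have hTq := hT.quasiMeasurePreserving
  have hsum : ∀ᵐ x ∂μ, ∀ N, birkhoffAvg T f N x = (N : ℝ)⁻¹ * birkhoffSum T g N (T x) := by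
    have := ae_all_iff.2 fun N => hTq.birkhoffSum_ae_eq_of_ae_eq hfg N
    filter_upwards [hTq.ae this] with x hx N
    rw [← hx N, birkhoffAvg, birkhoffSum, Finset.range_eq_Ico]
    exact congrArg _ (Finset.sum_Ico_add' (fun n => f (T^[n] x)) 0 N 1).symm
  have hfreq : ∃ᶠ x in ae μ, (∀ᶠ N in atTop, 0 ≤ birkhoffSum T g N x) ∨
      ∀ᶠ N in atTop, 0 ≤ birkhoffSum T (-g) N x := by
    intro hnot
    have hE' : ∃ᶠ x in ae μ, x ∈ E := frequently_ae_mem_iff.2 hEpos.ne'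
    obtain ⟨x, hxE, hx, hxn⟩ := (hE'.and_eventually (hsum.and (hTq.ae hnot))).exists
    refine hxn ((hE x hxE).imp (fun h => ?_) fun h => ?_)
    all_goals
      filter_upwards [h, eventually_gt_atTop 0] with N hN hN0
      have hN1 : (0 : ℝ) < (N : ℝ)⁻¹ := by positivity
      rw [hx] at hN
    · exact nonneg_of_mul_nonneg_right hN hN1
    · rw [birkhoffSum_neg, neg_nonneg]
      exact nonpos_of_mul_nonpos_right hN hN1
  rcases frequently_or_distrib.1 hfreq with h | h
  · obtain ⟨F, hF, hFb, hFe⟩ :=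
      exists_upperBarrier_of_frequently_birkhoffSum_nonneg hT hgm hgint hg0.le h
    exact ⟨F, hF, Or.inl hFb, hfg.trans hFe⟩
  · obtain ⟨F, hF, ⟨P, hP, hP0, p, hFp, hFle⟩, hFe⟩ :=
      exists_upperBarrier_of_frequently_birkhoffSum_nonneg hT hgm.neg hgint.neg
        (by simp [integral_neg, hg0]) h
    refine ⟨fun x => -F x, hF.neg, Or.inr ⟨P, hP, hP0, -p, fun x hx => congrArg Neg.neg (hFp x hx), ?_⟩, ?_⟩
    · filter_upwards [hFle] with y hy using neg_le_neg hy
    · filter_upwards [hfg, hFe] with x hx hx'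
      rw [Pi.neg_apply] at hx'
      linarith
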